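/- arXiv:math-ph/0602018 — 2 statements merged into one kernel-verified Lean document; each statement's English description precedes it below -/
import Mathlib

section
/- (Alexandrov–Zeeman) Let n ≥ 3 and let f : ℝⁿ → ℝⁿ be a bijection such that for all p, q: p − q is timelike and future-pointing (η(p−q, p−q) > 0 and (p−q)₀ > 0) if and only if f(p) − f(q) is timelike and future-pointing. Then f is the composition of a dilation with an inhomogeneous orthochronous Lorentz transformation: there exist λ > 0, a translation vector t ∈ ℝⁿ, and an n×n real matrix A satisfying η(A·v, A·w) = η(v, w) for all v, w and A₀₀ > 0 (orthochronous), such that f(p) = λ • (A·p) + t for all p. -/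
noncomputable section

/-- The Minkowski bilinear form on `ℝⁿ`:
`η(v,w) = v₀ w₀ − ∑_{i≠0} vᵢ wᵢ`. -/
def eta {n : ℕ} [NeZero n] (v w : Fin n → ℝ) : ℝ :=
  v 0 * w 0 - ∑ i ∈ Finset.univ.erase 0, v i * w i

end

section Minkowski

variable {n : ℕ} [NeZero n]

lemma eta_comm (v w : Fin n → ℝ) : eta v w = eta w v := by
  simp only [eta, mul_comm]

lemma eta_add_left (u v w : Fin n → ℝ) : eta (u + v) w = eta u w + eta v w := by
  simp only [eta, Pi.add_apply, add_mul, Finset.sum_add_distrib]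
  ring

lemma eta_smul_left (c : ℝ) (v w : Fin n → ℝ) : eta (c • v) w = c * eta v w := by
  simp only [eta, Pi.smul_apply, smul_eq_mul, mul_assoc, ← Finset.mul_sum]
  ring

lemma eta_add_right (u v w : Fin n → ℝ) : eta u (v + w) = eta u v + eta u w := by
  rw [eta_comm, eta_add_left, eta_comm v, eta_comm w]

lemma eta_smul_right (c : ℝ) (v w : Fin n → ℝ) : eta v (c • w) = c * eta v w := by
  rw [eta_comm, eta_smul_left, eta_comm w]

lemma eta_neg_left (v w : Fin n → ℝ) : eta (-v) w = -eta v w := by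
  rw [← neg_one_smul ℝ v, eta_smul_left, neg_one_mul]

lemma eta_neg_right (v w : Fin n → ℝ) : eta v (-w) = -eta v w := by
  rw [eta_comm, eta_neg_left, eta_comm w]

lemma eta_sub_left (u v w : Fin n → ℝ) : eta (u - v) w = eta u w - eta v w := by
  rw [sub_eq_add_neg, eta_add_left, eta_neg_left, sub_eq_add_neg]

lemma eta_sub_right (u v w : Fin n → ℝ) : eta u (v - w) = eta u v - eta u w := by
  rw [sub_eq_add_neg, eta_add_right, eta_neg_right, sub_eq_add_neg]

lemma eta_add_self (u v : Fin n → ℝ) :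
    eta (u + v) (u + v) = eta u u + 2 * eta u v + eta v v := by
  rw [eta_add_left, eta_add_right, eta_add_right, eta_comm v u]
  ring

lemma eta_sub_self (u v : Fin n → ℝ) :
    eta (u - v) (u - v) = eta u u - 2 * eta u v + eta v v := by
  rw [sub_eq_add_neg, eta_add_self, eta_neg_right, eta_neg_right, eta_neg_left]
  ring

lemma eta_smul_self (c : ℝ) (v : Fin n → ℝ) : eta (c • v) (c • v) = c ^ 2 * eta v v := by
  rw [eta_smul_left, eta_smul_right]
  ring

/-- The unit vector in the time direction. -/
def timeUnit (n : ℕ) [NeZero n] : Fin n → ℝ := Pi.single 0 1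

lemma timeUnit_zero : timeUnit n 0 = 1 := by simp [timeUnit]

lemma eta_timeUnit_left (v : Fin n → ℝ) : eta (timeUnit n) v = v 0 := by
  have : ∑ i ∈ Finset.univ.erase 0, timeUnit n i * v i = 0 :=
    Finset.sum_eq_zero fun i hi => by simp [timeUnit, Finset.ne_of_mem_erase hi]
  rw [eta, this, timeUnit_zero]
  ring

lemma eta_timeUnit_right (v : Fin n → ℝ) : eta v (timeUnit n) = v 0 := by
  rw [eta_comm, eta_timeUnit_left]

lemma eta_self (v : Fin n → ℝ) :
    eta v v = v 0 ^ 2 - ∑ i ∈ Finset.univ.erase 0, v i ^ 2 := by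
  simp only [eta, sq]

/-- A purely spatial vector which is not spacelike vanishes. -/
lemma eq_zero_of_spatial {v : Fin n → ℝ} (h0 : v 0 = 0) (h : 0 ≤ eta v v) : v = 0 := by
  rw [eta_self, h0] at h
  have hnonneg : ∀ i ∈ Finset.univ.erase (0 : Fin n), 0 ≤ v i ^ 2 := fun i _ => sq_nonneg _
  have hs : ∑ i ∈ Finset.univ.erase 0, v i ^ 2 = 0 :=
    le_antisymm (by linarith) (Finset.sum_nonneg hnonneg)
  rw [Finset.sum_eq_zero_iff_of_nonneg hnonneg] at hs
  funext i
  by_cases hi : i = 0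
  · rw [hi, h0, Pi.zero_apply]
  · exact pow_eq_zero_iff two_ne_zero |>.1 (hs i (by simp [hi]))

/-- A non-spacelike vector orthogonal to a nonzero lightlike vector is a multiple of it. -/
lemma exists_smul_of_eta_eq_zero {u v : Fin n → ℝ} (hu : eta u u = 0) (hu' : u ≠ 0)
    (huv : eta u v = 0) (hv : 0 ≤ eta v v) : ∃ k : ℝ, v = k • u := by
  have hu0 : u 0 ≠ 0 := fun h => hu' (eq_zero_of_spatial h hu.ge)
  have hw : u 0 • v - v 0 • u = 0 := by
    apply eq_zero_of_spatial
    · simp only [Pi.sub_apply, Pi.smul_apply, smul_eq_mul]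
      ring
    · rw [eta_sub_self, eta_smul_self, eta_smul_self, eta_smul_left, eta_smul_right,
        eta_comm v u, hu, huv]
      nlinarith [mul_nonneg (sq_nonneg (u 0)) hv]
  refine ⟨v 0 / u 0, ?_⟩
  rw [div_eq_inv_mul, mul_smul, ← sub_eq_zero.1 hw, smul_smul, inv_mul_cancel₀ hu0, one_smul]

/-- The open future cone. -/
def Chronological (v : Fin n → ℝ) : Prop := 0 < eta v v ∧ 0 < v 0

/-- The closed future cone. -/
def Causal (v : Fin n → ℝ) : Prop := 0 ≤ eta v v ∧ 0 ≤ v 0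

lemma Chronological.causal {v : Fin n → ℝ} (h : Chronological v) : Causal v :=
  ⟨h.1.le, h.2.le⟩

lemma Causal.eta_nonneg {v w : Fin n → ℝ} (hv : Causal v) (hw : Causal w) : 0 ≤ eta v w := by
  obtain ⟨hv, hv0⟩ := hv
  obtain ⟨hw, hw0⟩ := hw
  rw [eta_self, sub_nonneg] at hv hw
  have hcs := Finset.sum_mul_sq_le_sq_mul_sq (Finset.univ.erase (0 : Fin n)) v w
  have hsq : (∑ i ∈ Finset.univ.erase 0, v i * w i) ^ 2 ≤ (v 0 * w 0) ^ 2 := by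
    rw [mul_pow]
    exact hcs.trans (mul_le_mul hv hw (Finset.sum_nonneg fun i _ => sq_nonneg _) (sq_nonneg _))
  exact sub_nonneg.2 (abs_le_of_sq_le_sq' hsq (mul_nonneg hv0 hw0)).2

lemma Causal.add_chronological {v w : Fin n → ℝ} (hv : Causal v) (hw : Chronological w) :
    Chronological (v + w) := by
  have h := hv.eta_nonneg hw.causal
  refine ⟨?_, add_pos_of_nonneg_of_pos hv.2 hw.2⟩
  rw [eta_add_self]
  linarith [hv.1, hw.1]

lemma Chronological.smul {c : ℝ} (hc : 0 < c) {v : Fin n → ℝ} (hv : Chronological v) :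
    Chronological (c • v) := by
  refine ⟨?_, mul_pos hc hv.2⟩
  rw [eta_smul_left, eta_smul_right]
  exact mul_pos hc (mul_pos hc hv.1)

lemma chronological_timeUnit : Chronological (timeUnit n) := by
  simp [Chronological, eta_timeUnit_left, timeUnit_zero]

lemma nonneg_of_forall_quadratic_pos {a b c : ℝ}
    (h : ∀ ε : ℝ, 0 < ε → 0 < a + b * ε + c * ε ^ 2) : 0 ≤ a := by
  have hcont : Filter.Tendsto (fun ε : ℝ => a + b * ε + c * ε ^ 2)
      (nhdsWithin 0 (Set.Ioi 0)) (nhds a) := by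
    have : Continuous fun ε : ℝ => a + b * ε + c * ε ^ 2 := by fun_prop
    simpa using (this.tendsto 0).mono_left nhdsWithin_le_nhds
  exact ge_of_tendsto hcont (by
    filter_upwards [self_mem_nhdsWithin] with ε hε using (h ε hε).le)

lemma causal_of_forall_add_smul {v d : Fin n → ℝ}
    (h : ∀ ε : ℝ, 0 < ε → Chronological (v + ε • d)) : Causal v := by
  constructor
  · refine nonneg_of_forall_quadratic_pos (b := 2 * eta v d) (c := eta d d) fun ε hε => ?_
    have := (h ε hε).1
    rw [eta_add_self, eta_smul_right, eta_smul_self] at this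
    linarith
  · refine nonneg_of_forall_quadratic_pos (b := d 0) (c := 0) fun ε hε => ?_
    have := (h ε hε).2
    simp only [Pi.add_apply, Pi.smul_apply, smul_eq_mul] at this
    linarith

/-- The causal relation is determined by the chronological one. -/
lemma causal_sub_iff (p q : Fin n → ℝ) :
    Causal (p - q) ↔ ∀ r, Chronological (q - r) → Chronological (p - r) := by
  constructor
  · intro h r hr
    simpa using h.add_chronological hr
  · intro h
    refine causal_of_forall_add_smul (d := timeUnit n) fun ε hε => ?_
    have := h (q - ε • timeUnit n) (by simpa using chronological_timeUnit.smul hε)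
    convert this using 1
    abel

lemma eta_self_eq_zero_iff (v : Fin n → ℝ) :
    eta v v = 0 ↔
      (Causal v ∧ ¬ Chronological v) ∨ (Causal (-v) ∧ ¬ Chronological (-v)) := by
  have hpos : 0 < eta v v → v 0 ≠ 0 := by
    intro h h0
    rw [eq_zero_of_spatial h0 h.le, eta_self] at h
    simp at h
  simp only [Causal, Chronological, eta_neg_left, eta_neg_right, neg_neg, Pi.neg_apply]
  constructor
  · intro h
    rcases le_total 0 (v 0) with h0 | h0
    · exact Or.inl ⟨⟨h.ge, h0⟩, fun h' => h'.1.ne' h⟩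
    · exact Or.inr ⟨⟨h.ge, by linarith⟩, fun h' => h'.1.ne' h⟩
  · rintro (⟨⟨h, h0⟩, h'⟩ | ⟨⟨h, h0⟩, h'⟩)
    · by_contra hne
      have hlt := lt_of_le_of_ne h (Ne.symm hne)
      exact h' ⟨hlt, lt_of_le_of_ne h0 (hpos hlt).symm⟩
    · by_contra hne
      have hlt := lt_of_le_of_ne h (Ne.symm hne)
      exact h' ⟨hlt, lt_of_le_of_ne h0 (neg_ne_zero.2 (hpos hlt)).symm⟩

lemma lightlike_iff_of_chronological_iff {f : (Fin n → ℝ) → (Fin n → ℝ)}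
    (hf : Function.Surjective f)
    (hcone : ∀ p q, Chronological (p - q) ↔ Chronological (f p - f q)) (p q : Fin n → ℝ) :
    eta (p - q) (p - q) = 0 ↔ eta (f p - f q) (f p - f q) = 0 := by
  have hcausal : ∀ p q, Causal (p - q) ↔ Causal (f p - f q) := by
    intro p q
    rw [causal_sub_iff, causal_sub_iff]
    refine Iff.trans ?_ hf.forall.symm
    exact forall_congr' fun r => by rw [hcone q r, hcone p r]
  rw [eta_self_eq_zero_iff, eta_self_eq_zero_iff, neg_sub, neg_sub, hcausal p q, hcone p q,
    hcausal q p, hcone q p]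

lemma eta_single_left {i : Fin n} (hi : i ≠ 0) (v : Fin n → ℝ) :
    eta (Pi.single i 1) v = -v i := by
  simp [eta, Pi.single_apply, hi, hi.symm]

lemma exists_smul_unit_spatial {x : Fin n → ℝ} (hx : x ≠ 0) (hx0 : x 0 = 0) :
    ∃ (e : Fin n → ℝ) (c r : ℝ), e 0 = 0 ∧ eta e e = -1 ∧ e = c • x ∧ x = r • e := by
  have hneg : 0 < -eta x x := by
    by_contra h
    exact hx (eq_zero_of_spatial hx0 (by linarith))
  have hsqrt := Real.sqrt_pos.2 hneg
  refine ⟨(√(-eta x x))⁻¹ • x, (√(-eta x x))⁻¹, √(-eta x x), by simp [hx0], ?_, rfl, ?_⟩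
  · rw [eta_smul_self, inv_pow, Real.sq_sqrt hneg.le]
    have : eta x x ≠ 0 := by linarith
    field_simp
  · rw [smul_smul, mul_inv_cancel₀ hsqrt.ne', one_smul]

lemma exists_unit_spatial_orthogonal (hn : 3 ≤ n) (b : Fin n → ℝ) :
    ∃ e : Fin n → ℝ, e 0 = 0 ∧ eta e e = -1 ∧ eta e b = 0 := by
  obtain ⟨x, hx, hx0, hxb⟩ : ∃ x : Fin n → ℝ, x ≠ 0 ∧ x 0 = 0 ∧ eta x b = 0 := by
    let i : Fin n := ⟨1, by omega⟩
    let j : Fin n := ⟨2, by omega⟩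
    have hi : i ≠ 0 := by simp [i, Fin.ext_iff]
    have hj : j ≠ 0 := by simp [j, Fin.ext_iff]
    have hij : j ≠ i := by simp [i, j]
    by_cases hbi : b i = 0
    · exact ⟨Pi.single i 1, by simp, by simp [hi.symm], by rw [eta_single_left hi, hbi, neg_zero]⟩
    · refine ⟨b j • Pi.single i 1 - b i • Pi.single j 1, fun h => ?_,
        by simp [hi.symm, hj.symm], ?_⟩
      · have := congrFun h j
        simp [hij, hbi] at this
      · rw [eta_sub_left, eta_smul_left, eta_smul_left, eta_single_left hi, eta_single_left hj]
        ring
  obtain ⟨e, c, r, he0, hee, rfl, -⟩ := exists_smul_unit_spatial hx hx0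
  exact ⟨_, he0, hee, by rw [eta_smul_left, hxb, mul_zero]⟩

/-- Every vector is a combination of the time direction and a unit spatial vector. -/
lemma exists_eq_timeUnit_add_spatial (hn : 3 ≤ n) (v : Fin n → ℝ) :
    ∃ (e : Fin n → ℝ) (r : ℝ), e 0 = 0 ∧ eta e e = -1 ∧ v = v 0 • timeUnit n + r • e := by
  by_cases hx : v - v 0 • timeUnit n = 0
  · obtain ⟨e, he0, hee, -⟩ := exists_unit_spatial_orthogonal hn 0
    exact ⟨e, 0, he0, hee, by simpa using sub_eq_zero.1 hx⟩
  · obtain ⟨e, c, r, he0, hee, -, hr⟩ := exists_smul_unit_spatial hx (by simp [timeUnit_zero])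
    exact ⟨e, r, he0, hee, by rw [← hr, add_sub_cancel]⟩

lemma eta_timeUnit_add_spatial {e : Fin n → ℝ} (he0 : e 0 = 0) (hee : eta e e = -1) :
    eta (timeUnit n + e) (timeUnit n + e) = 0 := by
  rw [eta_add_self, hee, eta_timeUnit_left, eta_timeUnit_left, he0, timeUnit_zero]
  ring

lemma eta_timeUnit_sub_spatial {e : Fin n → ℝ} (he0 : e 0 = 0) (hee : eta e e = -1) :
    eta (timeUnit n - e) (timeUnit n - e) = 0 := by
  rw [eta_sub_self, hee, eta_timeUnit_left, eta_timeUnit_left, he0, timeUnit_zero]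
  ring

lemma exists_lightlike_add (hn : 3 ≤ n) (v : Fin n → ℝ) :
    ∃ a b : Fin n → ℝ, eta a a = 0 ∧ eta b b = 0 ∧ v = a + b := by
  obtain ⟨e, r, he0, hee, hv⟩ := exists_eq_timeUnit_add_spatial hn v
  refine ⟨((v 0 + r) / 2) • (timeUnit n + e), ((v 0 - r) / 2) • (timeUnit n - e), ?_, ?_, ?_⟩
  · rw [eta_smul_self, eta_timeUnit_add_spatial he0 hee, mul_zero]
  · rw [eta_smul_self, eta_timeUnit_sub_spatial he0 hee, mul_zero]
  · conv_lhs => rw [hv]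
    module

/-- The lightlike vectors not orthogonal to a given lightlike vector `b` generate the space. -/
lemma lightlike_induction (hn : 3 ≤ n) {b : Fin n → ℝ} (hb : eta b b = 0) (hb' : b ≠ 0)
    {P : (Fin n → ℝ) → Prop} (hP : ∀ a, eta a a = 0 → eta a b ≠ 0 → P a)
    (hadd : ∀ v w, P v → P w → P (v + w)) (v : Fin n → ℝ) : P v := by
  have hb0 : b 0 ≠ 0 := fun h => hb' (eq_zero_of_spatial h hb.ge)
  obtain ⟨e, he0, hee, heb⟩ := exists_unit_spatial_orthogonal hn b
  have hray (s : ℝ) (hs : s ≠ 0) : P (s • (timeUnit n + e)) := by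
    apply hP
    · rw [eta_smul_self, eta_timeUnit_add_spatial he0 hee, mul_zero]
    · rw [eta_smul_left, eta_add_left, heb, eta_timeUnit_left, add_zero]
      exact mul_ne_zero hs hb0
  have hzero : P 0 := by
    have := hadd _ _ (hray 1 one_ne_zero) (hray (-1) (by norm_num))
    rwa [← add_smul, add_neg_cancel, zero_smul] at this
  have hmul : ∀ k : ℝ, P (k • b) := by
    intro k
    rcases eq_or_ne k 0 with rfl | hk
    · rwa [zero_smul]
    have hkb : k * b 0 ≠ 0 := mul_ne_zero hk hb0
    have hreflected : P ((k * b 0) • (timeUnit n - e)) := by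
      apply hP
      · rw [eta_smul_self, eta_timeUnit_sub_spatial he0 hee, mul_zero]
      · rw [eta_smul_left, eta_sub_left, heb, eta_timeUnit_left, sub_zero]
        exact mul_ne_zero hkb hb0
    have hopposite : P (k • (b - (2 * b 0) • timeUnit n)) := by
      apply hP
      · rw [eta_smul_self, eta_sub_self, eta_smul_self, eta_smul_right, hb,
          eta_timeUnit_left, eta_timeUnit_right, timeUnit_zero]
        ring
      · rw [eta_smul_left, eta_sub_left, eta_smul_left, hb, eta_timeUnit_left]
        have : k * (0 - 2 * b 0 * b 0) = -2 * (k * b 0) * b 0 := by ring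
        rw [this]
        exact mul_ne_zero (mul_ne_zero (by norm_num) hkb) hb0
    convert hadd _ _ (hadd _ _ (hray _ hkb) hreflected) hopposite using 1
    module
  have hnull : ∀ a : Fin n → ℝ, eta a a = 0 → P a := by
    intro a ha
    by_cases hab : eta a b = 0
    · obtain ⟨k, rfl⟩ := exists_smul_of_eta_eq_zero hb hb' (by rw [eta_comm, hab]) ha.ge
      exact hmul k
    · exact hP a ha hab
  obtain ⟨a, c, ha, hc, rfl⟩ := exists_lightlike_add hn v
  exact hadd _ _ (hnull a ha) (hnull c hc)

section LightlikeMap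

variable {f : (Fin n → ℝ) → (Fin n → ℝ)}

/-- Three points with pairwise lightlike differences are collinear. -/
lemma exists_smul_of_lightlike_sub {u v : Fin n → ℝ} (hu : eta u u = 0) (hu' : u ≠ 0)
    (hv : eta v v = 0) (huv : eta (v - u) (v - u) = 0) : ∃ k : ℝ, v = k • u := by
  refine exists_smul_of_eta_eq_zero hu hu' ?_ hv.ge
  rw [eta_sub_self, hu, hv, eta_comm] at huv
  linarith

lemma map_add_smul_lightlike (hf : Function.Injective f)
    (hlight : ∀ p q, eta (p - q) (p - q) = 0 ↔ eta (f p - f q) (f p - f q) = 0)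
    {a : Fin n → ℝ} (ha : eta a a = 0) (ha' : a ≠ 0) (p : Fin n → ℝ) (t : ℝ) :
    ∃ s : ℝ, f (p + t • a) - f p = s • (f (p + a) - f p) := by
  apply exists_smul_of_lightlike_sub
  · rw [← hlight, add_sub_cancel_left, ha]
  · rw [sub_ne_zero, hf.ne_iff]
    simpa using ha'
  · rw [← hlight, add_sub_cancel_left, eta_smul_self, ha]
    simp
  · rw [sub_sub_sub_cancel_right, ← hlight]
    have : p + t • a - (p + a) = (t - 1) • a := by module
    rw [this, eta_smul_self, ha]
    simp

lemma exists_map_eq_add_smul (hf : Function.Bijective f)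
    (hlight : ∀ p q, eta (p - q) (p - q) = 0 ↔ eta (f p - f q) (f p - f q) = 0)
    {a : Fin n → ℝ} (ha : eta a a = 0) (ha' : a ≠ 0) (p : Fin n → ℝ) (s : ℝ) :
    ∃ t : ℝ, f (p + t • a) = f p + s • (f (p + a) - f p) := by
  obtain ⟨x, hx⟩ := hf.2 (f p + s • (f (p + a) - f p))
  have hnull : eta (f (p + a) - f p) (f (p + a) - f p) = 0 := by
    rw [← hlight, add_sub_cancel_left, ha]
  obtain ⟨k, hk⟩ : ∃ k : ℝ, x - p = k • a := by
    apply exists_smul_of_lightlike_sub ha ha'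
    · rw [hlight, hx, add_sub_cancel_left, eta_smul_self, hnull]
      simp
    · rw [sub_sub, hlight, hx]
      have : f p + s • (f (p + a) - f p) - f (p + a) = (s - 1) • (f (p + a) - f p) := by module
      rw [this, eta_smul_self, hnull]
      simp
  exact ⟨k, by rw [← hk, add_sub_cancel, hx]⟩

/-- Parallel lightlike lines not lying in a common null hyperplane have parallel images. -/
lemma map_parallel (hf : Function.Bijective f)
    (hlight : ∀ p q, eta (p - q) (p - q) = 0 ↔ eta (f p - f q) (f p - f q) = 0)
    {a : Fin n → ℝ} (ha : eta a a = 0) {p q : Fin n → ℝ} (hpq : eta (q - p) a ≠ 0) :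
    ∃ k : ℝ, f (q + a) - f q = k • (f (p + a) - f p) := by
  have ha' : a ≠ 0 := by
    rintro rfl
    exact hpq (by simp [eta])
  have hnull : ∀ p, eta (f (p + a) - f p) (f (p + a) - f p) = 0 := fun p => by
    rw [← hlight, add_sub_cancel_left, ha]
  have hne : ∀ p, f (p + a) - f p ≠ 0 := fun p => by
    rw [sub_ne_zero, hf.1.ne_iff]
    simpa using ha'
  refine exists_smul_of_eta_eq_zero (hnull p) (hne p) ?_ (hnull q).ge
  by_contra hab
  set a' := f (p + a) - f p with ha'def
  set b' := f (q + a) - f q with hb'def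
  obtain ⟨s, hs⟩ : ∃ s : ℝ, eta (f q - f p - s • a') b' = 0 :=
    ⟨eta (f q - f p) b' / eta a' b', by
      rw [eta_sub_left, eta_smul_left, div_mul_cancel₀ _ hab, sub_self]⟩
  obtain ⟨t, ht⟩ := exists_map_eq_add_smul hf hlight ha ha' p s
  rw [← ha'def] at ht
  obtain ⟨r, hr⟩ : ∃ r : ℝ,
      eta (q + r • a - (p + t • a)) (q + r • a - (p + t • a)) = 0 := by
    refine ⟨t - eta (q - p) (q - p) / (2 * eta (q - p) a), ?_⟩
    generalize hm : eta (q - p) (q - p) / (2 * eta (q - p) a) = m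
    have hm' : eta (q - p) (q - p) = m * (2 * eta (q - p) a) := by
      rw [← hm]
      field_simp
    have : q + (t - m) • a - (p + t • a) = (q - p) - m • a := by module
    rw [this, eta_sub_self, eta_smul_right, eta_smul_self, ha, hm']
    ring
  rw [hlight, ht] at hr
  obtain ⟨r', hr'⟩ := map_add_smul_lightlike hf.1 hlight ha ha' q r
  rw [← hb'def] at hr'
  obtain ⟨k, hk⟩ : ∃ k : ℝ, f (q + r • a) - (f p + s • a') = k • b' := by
    refine exists_smul_of_eta_eq_zero (hnull q) (hne q) ?_ hr.ge
    have : f (q + r • a) - (f p + s • a') = (f q - f p - s • a') + r' • b' := by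
      rw [← hr']
      abel
    rw [this, eta_add_right, eta_smul_right, eta_comm b', hs, hnull q]
    simp
  obtain ⟨t', ht'⟩ := exists_map_eq_add_smul hf hlight ha ha' q (r' - k)
  rw [← hb'def] at ht'
  have hmeet : f (q + t' • a) = f (p + t • a) := by
    rw [ht, ht', sub_smul, ← hr', ← hk]
    abel
  have hqp : q - p = (t - t') • a := by
    have := hf.1 hmeet
    rw [sub_smul, sub_eq_sub_iff_add_eq_add, this]
    abel
  exact hpq (by rw [hqp, eta_smul_left, ha, mul_zero])

/-- Lightlike parallelograms are mapped to parallelograms. -/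
lemma map_parallelogram (hf : Function.Bijective f)
    (hlight : ∀ p q, eta (p - q) (p - q) = 0 ↔ eta (f p - f q) (f p - f q) = 0)
    {a b : Fin n → ℝ} (ha : eta a a = 0) (hb : eta b b = 0) (hab : eta a b ≠ 0)
    (p : Fin n → ℝ) : f (p + a + b) - f (p + a) = f (p + b) - f p := by
  obtain ⟨s, hs⟩ := map_parallel hf hlight hb (p := p) (q := p + a) (by simpa using hab)
  obtain ⟨t, ht⟩ := map_parallel hf hlight ha (p := p) (q := p + b)
    (by simpa [eta_comm b] using hab)
  have ha' : eta (f (p + a) - f p) (f (p + a) - f p) = 0 := by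
    rw [← hlight, add_sub_cancel_left, ha]
  have hb' : eta (f (p + b) - f p) (f (p + b) - f p) = 0 := by
    rw [← hlight, add_sub_cancel_left, hb]
  have hab' : eta (f (p + a) - f p) (f (p + b) - f p) ≠ 0 := by
    intro h
    have hne : ¬ eta ((p + a) - (p + b)) ((p + a) - (p + b)) = 0 := by
      rw [add_sub_add_left_eq_sub]
      rw [eta_sub_self, ha, hb]
      intro h'
      exact hab (by linarith)
    refine hne ((hlight _ _).2 ?_)
    rw [← sub_sub_sub_cancel_right (f (p + a)) (f (p + b)) (f p), eta_sub_self,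
      h, ha', hb']
    simp
  have hsum : (s - 1) • (f (p + b) - f p) = (t - 1) • (f (p + a) - f p) := by
    rw [sub_smul, sub_smul, ← hs, ← ht, one_smul, one_smul, add_right_comm p b a]
    abel
  have hs1 : s = 1 := by
    have := congrArg (eta (f (p + a) - f p)) hsum
    rw [eta_smul_right, eta_smul_right, ha', mul_zero, mul_eq_zero] at this
    linarith [this.resolve_right hab']
  rw [hs, hs1, one_smul]

/-- A bijection preserving lightlike separation is additive up to a translation. -/
lemma map_add_sub_map (hn : 3 ≤ n) (hf : Function.Bijective f)
    (hlight : ∀ p q, eta (p - q) (p - q) = 0 ↔ eta (f p - f q) (f p - f q) = 0)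
    (p v : Fin n → ℝ) : f (p + v) - f p = f v - f 0 := by
  have hnull : ∀ b : Fin n → ℝ, eta b b = 0 → ∀ p v, f (p + v + b) - f (p + v) =
      f (p + b) - f p := by
    intro b hb
    rcases eq_or_ne b 0 with rfl | hb'
    · simp
    intro p v
    refine lightlike_induction hn (P := fun v => ∀ p, f (p + v + b) - f (p + v) = f (p + b) - f p)
      hb hb' ?_ ?_ v p
    · intro a ha hab p
      exact map_parallelogram hf hlight ha hb hab p
    · intro v w hv hw p
      rw [← add_assoc, hw, hv]
  obtain ⟨a, b, ha, hb, rfl⟩ := exists_lightlike_add hn v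
  have h1 := hnull b hb p a
  have h2 := hnull b hb 0 a
  have h3 := hnull a ha 0 p
  have h4 := hnull b hb 0 p
  simp only [zero_add] at h2 h3 h4
  rw [← add_assoc, ← sub_add_sub_cancel _ (f (p + a)), h1, h3, h4,
    ← sub_add_sub_cancel (f (a + b)) (f a), h2]

end LightlikeMap

/-- Every vector can be moved into the open future cone by a time translation. -/
lemma exists_chronological_add (v : Fin n → ℝ) :
    ∃ m : ℝ, 0 < m ∧ Chronological (v + m • timeUnit n) := by
  have hS : 0 ≤ ∑ i ∈ Finset.univ.erase 0, v i ^ 2 := Finset.sum_nonneg fun i _ => sq_nonneg _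
  have hv := eta_self v
  set S := ∑ i ∈ Finset.univ.erase 0, v i ^ 2
  have habs := neg_abs_le (v 0)
  refine ⟨|v 0| + S + 1, by positivity, ?_, ?_⟩
  · rw [eta_add_self, eta_smul_right, eta_smul_self, eta_timeUnit_right, eta_timeUnit_right,
      timeUnit_zero, hv]
    nlinarith [mul_nonneg hS hS]
  · simp only [Pi.add_apply, Pi.smul_apply, timeUnit_zero, smul_eq_mul]
    linarith

/-- An additive map preserving the open future cone is linear. -/
lemma map_smul_of_chronological (g : (Fin n → ℝ) →+ (Fin n → ℝ))
    (hg : ∀ v, Chronological v → Chronological (g v)) (t : ℝ) (v : Fin n → ℝ) :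
    g (t • v) = t • g v := by
  have hrat : ∀ (q : ℚ) v, g ((q : ℝ) • v) = (q : ℝ) • g v := fun q v =>
    map_ratCast_smul g ℝ ℝ q v
  have hcone : ∀ v, Chronological v → g (t • v) = t • g v := by
    intro v hv
    have hpos : Causal (g (t • v) - t • g v) := by
      refine causal_of_forall_add_smul (d := g v) fun ε hε => ?_
      obtain ⟨q, hq1, hq2⟩ := exists_rat_btwn (sub_lt_self t hε)
      have h1 := hg _ (hv.smul (sub_pos.2 hq2))
      have h2 := (hg _ hv).smul (c := ε - (t - q)) (by linarith)
      rw [sub_smul, map_sub, hrat] at h1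
      convert h1.causal.add_chronological h2 using 1
      module
    have hneg : Causal (t • g v - g (t • v)) := by
      refine causal_of_forall_add_smul (d := g v) fun ε hε => ?_
      obtain ⟨q, hq1, hq2⟩ := exists_rat_btwn (lt_add_of_pos_right t hε)
      have h1 := hg _ (hv.smul (sub_pos.2 hq1))
      have h2 := (hg _ hv).smul (c := ε - (q - t)) (by linarith)
      rw [sub_smul, map_sub, hrat] at h1
      convert h1.causal.add_chronological h2 using 1
      module
    have h0 := hpos.2
    have h0' := hneg.2
    simp only [Pi.sub_apply] at h0 h0'
    exact sub_eq_zero.1 (eq_zero_of_spatial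
      (by simp only [Pi.sub_apply]; linarith) hpos.1)
  obtain ⟨m, hm, hv⟩ := exists_chronological_add v
  have h1 := hcone _ hv
  have h2 := hcone _ (chronological_timeUnit.smul hm)
  rw [smul_add, map_add, map_add, smul_add, h2] at h1
  exact add_right_cancel h1

/-- A linear map preserving the null cone rescales the Minkowski form. -/
lemma eta_map_of_lightlike (hn : 3 ≤ n) (g : (Fin n → ℝ) →ₗ[ℝ] (Fin n → ℝ))
    (hg : ∀ v, eta v v = 0 → eta (g v) (g v) = 0) (v w : Fin n → ℝ) :
    eta (g v) (g w) = eta (g (timeUnit n)) (g (timeUnit n)) * eta v w := by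
  have hself : ∀ v, eta (g v) (g v) = eta (g (timeUnit n)) (g (timeUnit n)) * eta v v := by
    intro v
    obtain ⟨e, r, he0, hee, hv⟩ := exists_eq_timeUnit_add_spatial hn v
    have h1 := hg _ (eta_timeUnit_add_spatial he0 hee)
    have h2 := hg _ (eta_timeUnit_sub_spatial he0 hee)
    rw [map_add, eta_add_self] at h1
    rw [map_sub, eta_sub_self] at h2
    have horth : eta (g (timeUnit n)) (g e) = 0 := by linarith
    have hee' : eta (g e) (g e) = -eta (g (timeUnit n)) (g (timeUnit n)) := by linarith
    rw [hv]
    generalize v 0 = s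
    rw [map_add, map_smul, map_smul, eta_add_self, eta_add_self, eta_smul_self, eta_smul_self,
      eta_smul_self, eta_smul_self, eta_smul_left, eta_smul_right, eta_smul_left,
      eta_smul_right, horth, hee', hee, eta_timeUnit_left, eta_timeUnit_left, he0, timeUnit_zero]
    ring
  have h := hself (v + w)
  rw [map_add, eta_add_self, eta_add_self, hself v, hself w] at h
  linarith

end Minkowski

open Matrix in
/-- **Alexandrov–Zeeman theorem**: a bijection of `ℝⁿ` (`n ≥ 3`) which together
with its inverse preserves the relation "timelike and future-pointing
separation" is the composition of a dilation with an inhomogeneous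
orthochronous Lorentz transformation. -/
theorem alexandrov_zeeman {n : ℕ} [NeZero n] (hn : 3 ≤ n)
    (f : (Fin n → ℝ) → (Fin n → ℝ)) (hf : Function.Bijective f)
    (hcone : ∀ p q : Fin n → ℝ,
      (0 < eta (p - q) (p - q) ∧ 0 < (p - q) 0) ↔
      (0 < eta (f p - f q) (f p - f q) ∧ 0 < (f p - f q) 0)) :
    ∃ (lam : ℝ) (t : Fin n → ℝ) (A : Matrix (Fin n) (Fin n) ℝ),
      0 < lam ∧ (∀ v w, eta (A *ᵥ v) (A *ᵥ w) = eta v w) ∧ 0 < A 0 0 ∧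
      ∀ p, f p = lam • (A *ᵥ p) + t := by
  have hcone' : ∀ p q, Chronological (p - q) ↔ Chronological (f p - f q) := hcone
  have hlight := lightlike_iff_of_chronological_iff hf.2 hcone'
  have hadd := map_add_sub_map hn hf hlight
  let g₀ : (Fin n → ℝ) →+ (Fin n → ℝ) :=
    { toFun := fun v => f v - f 0
      map_zero' := sub_self _
      map_add' := fun p v => by rw [← hadd p v]; abel }
  have hchron : ∀ v, Chronological v → Chronological (f v - f 0) := fun v hv =>
    (hcone' v 0).1 (by rwa [sub_zero])
  let g : (Fin n → ℝ) →ₗ[ℝ] (Fin n → ℝ) :=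
    { g₀ with map_smul' := map_smul_of_chronological g₀ hchron }
  have hg : ∀ v, g v = f v - f 0 := fun v => rfl
  have hgnull : ∀ v, eta v v = 0 → eta (g v) (g v) = 0 := fun v hv =>
    (hlight v 0).1 (by rwa [sub_zero])
  have hscale := eta_map_of_lightlike hn g hgnull
  obtain ⟨hc, htime⟩ : Chronological (g (timeUnit n)) := hchron _ chronological_timeUnit
  set c := eta (g (timeUnit n)) (g (timeUnit n))
  have hsqrt : 0 < √c := Real.sqrt_pos.2 hc
  have hA : ∀ v, LinearMap.toMatrix' ((√c)⁻¹ • g) *ᵥ v = (√c)⁻¹ • g v := fun v => by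
    rw [LinearMap.toMatrix'_mulVec, LinearMap.smul_apply]
  refine ⟨√c, f 0, LinearMap.toMatrix' ((√c)⁻¹ • g), hsqrt, fun v w => ?_, ?_, fun p => ?_⟩
  · rw [hA, hA, eta_smul_left, eta_smul_right, hscale]
    field_simp
    rw [Real.sq_sqrt hc.le]
  · have h00 : LinearMap.toMatrix' ((√c)⁻¹ • g) 0 0 = (√c)⁻¹ * g (timeUnit n) 0 := by
      simp [LinearMap.toMatrix'_apply, timeUnit]
    rw [h00]
    exact mul_pos (inv_pos.2 hsqrt) htime
  · rw [hA, smul_smul, mul_inv_cancel₀ hsqrt.ne', one_smul, hg, sub_add_cancel]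
end

section
/- (Beckman–Quarles) Let n ≥ 2, let δ > 0, and let f : ℝⁿ → ℝⁿ be any map (not assumed bijective or continuous) on Euclidean n-space such that for all x, y, if dist(x, y) = δ then dist(f(x), f(y)) = δ. Then f preserves all distances: dist(f(x), f(y)) = dist(x, y) for all x, y; hence f is a Euclidean motion, i.e. an affine isometry of ℝⁿ. -/
/-- The map `f` preserves the distance `d`. -/
def PreservesDist {E : Type*} [Dist E] (f : E → E) (d : ℝ) : Prop :=
  ∀ x y, dist x y = d → dist (f x) (f y) = d

section InnerProduct

variable {E : Type*} [NormedAddCommGroup E] [InnerProductSpace ℝ E]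

theorem exists_isometry_map_pair {x y x' y' : E} (h : dist x y = dist x' y') :
    ∃ g : E → E, Isometry g ∧ g x = x' ∧ g y = y' := by
  have hn : ‖y - x‖ = ‖y' - x'‖ := by
    rw [← dist_eq_norm, ← dist_eq_norm, dist_comm, h, dist_comm]
  refine ⟨fun p => (ℝ ∙ ((y - x) - (y' - x')))ᗮ.reflection (p - x) + x', ?_, ?_, ?_⟩
  · refine Isometry.of_dist_eq fun p q => ?_
    simp
  · simp
  · simp [Submodule.reflection_sub hn]

theorem exists_norm_eq_one_inner_eq_zero (hE : 2 ≤ Module.finrank ℝ E) (v : E) :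
    ∃ u : E, ‖u‖ = 1 ∧ inner ℝ v u = 0 := by
  have : FiniteDimensional ℝ E := FiniteDimensional.of_finrank_pos (by omega)
  have hne : (ℝ ∙ v)ᗮ ≠ ⊥ := by
    intro hbot
    have h₁ := (ℝ ∙ v).finrank_add_finrank_orthogonal
    have h₂ := finrank_span_le_card (R := ℝ) ({v} : Set E)
    rw [hbot, finrank_bot] at h₁
    simp only [Set.toFinset_singleton, Finset.card_singleton] at h₂
    omega
  obtain ⟨w, hw, hw0⟩ := Submodule.exists_mem_ne_zero_of_ne_bot hne
  refine ⟨‖w‖⁻¹ • w, norm_smul_inv_norm (𝕜 := ℝ) hw0, ?_⟩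
  rw [inner_smul_right, Submodule.mem_orthogonal_singleton_iff_inner_right.1 hw, mul_zero]

/-- Isosceles triangles with prescribed base exist. -/
theorem exists_dist_eq_of_dist_le_two_mul (hE : 2 ≤ Module.finrank ℝ E) {x y : E} {b : ℝ}
    (h : dist x y ≤ 2 * b) : ∃ z, dist x z = b ∧ dist y z = b := by
  obtain ⟨u, hu, huv⟩ := exists_norm_eq_one_inner_eq_zero hE (y - x)
  have hb : 0 ≤ b := by linarith [dist_nonneg (x := x) (y := y)]
  have hs : 0 ≤ b ^ 2 - (dist x y / 2) ^ 2 := by nlinarith [dist_nonneg (x := x) (y := y)]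
  set s := √(b ^ 2 - (dist x y / 2) ^ 2)
  have hss : s ^ 2 = b ^ 2 - (dist x y / 2) ^ 2 := Real.sq_sqrt hs
  have hd : dist x y = ‖y - x‖ := by rw [dist_comm, dist_eq_norm]
  refine ⟨x + (1 / 2 : ℝ) • (y - x) + s • u, ?_, ?_⟩
  · rw [dist_comm, dist_eq_norm, ← sq_eq_sq₀ (norm_nonneg _) hb,
      show x + (1 / 2 : ℝ) • (y - x) + s • u - x = (1 / 2 : ℝ) • (y - x) + s • u by abel,
      norm_add_sq_real, norm_smul, norm_smul, inner_smul_left, inner_smul_right, huv, hu, mul_pow,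
      mul_pow, ← hd, Real.norm_eq_abs, Real.norm_eq_abs, sq_abs, sq_abs, hss]
    simp
    ring
  · rw [dist_comm, dist_eq_norm, ← sq_eq_sq₀ (norm_nonneg _) hb,
      show x + (1 / 2 : ℝ) • (y - x) + s • u - y = (-1 / 2 : ℝ) • (y - x) + s • u by module,
      norm_add_sq_real, norm_smul, norm_smul, inner_smul_left, inner_smul_right, huv, hu, mul_pow,
      mul_pow, ← hd, Real.norm_eq_abs, Real.norm_eq_abs, sq_abs, sq_abs, hss]
    simp
    ring

/-- Any segment can be prolonged, or shortened, to any prescribed length. -/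
theorem exists_dist_eq_dist_eq_abs_sub {x y : E} (hxy : x ≠ y) {D : ℝ} (hD : 0 ≤ D) :
    ∃ z, dist x z = D ∧ dist y z = |D - dist x y| := by
  have hd : 0 < ‖y - x‖ := norm_pos_iff.2 (sub_ne_zero.2 hxy.symm)
  have hd' : dist x y = ‖y - x‖ := by rw [dist_comm, dist_eq_norm]
  refine ⟨x + (D / ‖y - x‖) • (y - x), ?_, ?_⟩
  · rw [dist_comm, dist_eq_norm, add_sub_cancel_left, norm_smul, Real.norm_eq_abs,
      abs_of_nonneg (by positivity)]
    field_simp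
  · rw [dist_comm, dist_eq_norm,
      show x + (D / ‖y - x‖) • (y - x) - y = (D / ‖y - x‖ - 1) • (y - x) by module,
      norm_smul, Real.norm_eq_abs, hd']
    nth_rewrite 2 [← abs_of_pos hd]
    rw [← abs_mul, sub_mul, one_mul, div_mul_cancel₀ _ hd.ne']

/-- If `f` does not expand the distance `ε`, it does not expand distances beyond `N * ε`. -/
theorem dist_map_le_natCast_mul (hE : 2 ≤ Module.finrank ℝ E) {f : E → E} {ε : ℝ} (hε : 0 < ε)
    (hf : ∀ x y, dist x y = ε → dist (f x) (f y) ≤ ε) {N : ℕ} (hN : 2 ≤ N) :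
    ∀ x y, dist x y ≤ N * ε → dist (f x) (f y) ≤ N * ε := by
  induction N, hN using Nat.le_induction with
  | base =>
    intro x y h
    push_cast at h ⊢
    obtain ⟨z, hxz, hyz⟩ := exists_dist_eq_of_dist_le_two_mul hE h
    linarith [dist_triangle_right (f x) (f y) (f z), hf _ _ hxz, hf _ _ hyz]
  | succ N hN ih =>
    intro x y h
    push_cast at h ⊢
    rcases le_or_gt (dist x y) (N * ε) with h' | h'
    · linarith [ih x y h']
    · have hN' : (2 : ℝ) ≤ N := by exact_mod_cast hN
      have hεd : ε ≤ dist x y := by nlinarith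
      have hne : x ≠ y := dist_pos.1 (hε.trans_le hεd)
      obtain ⟨z, hxz, hyz⟩ := exists_dist_eq_dist_eq_abs_sub hne hε.le
      rw [abs_of_nonpos (by linarith)] at hyz
      have := ih y z (by linarith)
      linarith [dist_triangle_right (f x) (f y) (f z), hf _ _ hxz]

/-- A map preserving arbitrarily large distances and sending each pair of points at distance `h`
to a pair at distance `0` or `h` preserves the distance `h`. -/
theorem PreservesDist.of_eq_or_dist_eq (hE : 2 ≤ Module.finrank ℝ E) {f : E → E}
    (hlarge : ∀ M, ∃ D, M ≤ D ∧ PreservesDist f D) {h : ℝ} (hh : 0 < h)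
    (hf : ∀ x y, dist x y = h → f x = f y ∨ dist (f x) (f y) = h) : PreservesDist f h := by
  intro x y hxy
  refine (hf x y hxy).resolve_left fun heq => ?_
  obtain ⟨D, hD, hfD⟩ := hlarge (3 * h)
  obtain ⟨z, hxz, hyz⟩ :=
    exists_dist_eq_dist_eq_abs_sub (dist_pos.1 (hxy ▸ hh)) (show 0 ≤ D by linarith)
  rw [hxy, abs_of_nonneg (by linarith)] at hyz
  have h3 : (3 : ℝ) ≤ D / h := (le_div_iff₀ hh).2 hD
  obtain ⟨N, hN⟩ : ∃ N, ⌈D / h⌉₊ = N + 1 :=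
    Nat.exists_eq_succ_of_ne_zero (Nat.ceil_pos.2 (by linarith)).ne'
  have hle : D / h ≤ N + 1 := by
    have := Nat.le_ceil (D / h)
    rw [hN] at this
    exact_mod_cast this
  have hlt : (N : ℝ) < D / h := Nat.lt_ceil.1 (by omega)
  have hN2 : 2 ≤ N := by
    have : (2 : ℝ) ≤ N := by linarith
    exact_mod_cast this
  rw [div_le_iff₀ hh] at hle
  rw [lt_div_iff₀ hh] at hlt
  have hle' : ∀ p q, dist p q = h → dist (f p) (f q) ≤ h := by
    intro p q hpq
    rcases hf p q hpq with e | e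
    · rw [e, dist_self]; exact hh.le
    · exact e.le
  have h₁ := dist_map_le_natCast_mul hE hh hle' hN2 y z (by linarith)
  rw [← heq, hfD x z hxz] at h₁
  linarith

/-- A map preserving arbitrarily small and arbitrarily large distances is an isometry. -/
theorem isometry_of_preservesDist_small_large (hE : 2 ≤ Module.finrank ℝ E) {f : E → E}
    (hsmall : ∀ η > 0, ∃ ε, 0 < ε ∧ ε ≤ η ∧ PreservesDist f ε)
    (hlarge : ∀ M, ∃ D, M ≤ D ∧ PreservesDist f D) : Isometry f := by
  have hle : ∀ x y, dist (f x) (f y) ≤ dist x y := by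
    intro x y
    refine le_of_forall_pos_le_add fun η hη => ?_
    obtain ⟨ε, hε, hεη, hfε⟩ := hsmall (η / 3) (by linarith)
    have h₁ : dist x y ≤ ((⌈dist x y / ε⌉₊ + 2 : ℕ) : ℝ) * ε := by
      have := (div_le_iff₀ hε).1 (Nat.le_ceil (dist x y / ε))
      push_cast
      linarith
    have h₂ := dist_map_le_natCast_mul hE hε (fun p q h => (hfε p q h).le) (by omega) x y h₁
    have h₃ := Nat.ceil_lt_add_one (show 0 ≤ dist x y / ε by positivity)
    have h₄ : (⌈dist x y / ε⌉₊ : ℝ) * ε ≤ (dist x y / ε + 1) * ε := by gcongr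
    rw [add_mul, div_mul_cancel₀ _ hε.ne'] at h₄
    push_cast at h₂
    linarith
  refine Isometry.of_dist_eq fun x y => (hle x y).antisymm ?_
  rcases eq_or_ne x y with rfl | hne
  · simp
  obtain ⟨D, hD, hfD⟩ := hlarge (dist x y)
  obtain ⟨z, hxz, hyz⟩ := exists_dist_eq_dist_eq_abs_sub hne (dist_nonneg.trans hD)
  rw [abs_of_nonneg (by linarith)] at hyz
  linarith [dist_triangle (f x) (f y) (f z), hle y z, hfD x z hxz]

/-- Preserving `a` and `3 * a` forces preserving `2 * a`. -/
theorem PreservesDist.two_mul (hE : 2 ≤ Module.finrank ℝ E) {f : E → E} {a : ℝ} (ha : 0 < a)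
    (h₁ : PreservesDist f a) (h₃ : PreservesDist f (3 * a)) : PreservesDist f (2 * a) := by
  intro x y hxy
  refine le_antisymm ?_ ?_
  · have := dist_map_le_natCast_mul hE ha (fun p q h => (h₁ p q h).le) le_rfl x y
      (by push_cast; exact hxy.le)
    exact_mod_cast this
  · obtain ⟨z, hxz, hyz⟩ :=
      exists_dist_eq_dist_eq_abs_sub (dist_pos.1 (show 0 < dist x y by linarith))
        (show 0 ≤ 3 * a by linarith)
    rw [hxy, abs_of_nonneg (by linarith)] at hyz
    linarith [dist_triangle (f x) (f y) (f z), h₃ x z hxz, h₁ y z (by linarith)]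

/-- Preserving `a` and `2 * a` forces preserving `a / 2`, since midpoints of segments of length
`2 * a` are preserved. -/
theorem PreservesDist.half (hE : 2 ≤ Module.finrank ℝ E) {f : E → E} {a : ℝ} (ha : 0 < a)
    (h₁ : PreservesDist f a) (h₂ : PreservesDist f (2 * a)) : PreservesDist f (a / 2) := by
  intro x y hxy
  obtain ⟨z, hxz, hyz⟩ := exists_dist_eq_of_dist_le_two_mul hE (b := a)
    (show dist x y ≤ 2 * a by linarith)
  have key : ∀ p, dist p z = a →
      f p = midpoint ℝ (f z) (f (AffineMap.lineMap z p (2 : ℝ))) := by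
    intro p hp
    have hz : dist z (AffineMap.lineMap z p (2 : ℝ)) = 2 * a := by
      rw [dist_left_lineMap, dist_comm, hp]; simp
    have hp' : dist p (AffineMap.lineMap z p (2 : ℝ)) = a := by
      rw [dist_comm, dist_lineMap_right, dist_comm z p, hp]; norm_num
    apply eq_midpoint_of_dist_eq_half
    · rw [h₂ _ _ hz, h₁ _ _ (by rw [dist_comm, hp])]; ring
    · rw [h₂ _ _ hz, h₁ _ _ hp']; ring
  have hXY : dist (AffineMap.lineMap z x (2 : ℝ)) (AffineMap.lineMap z y (2 : ℝ)) = a := by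
    rw [AffineMap.lineMap_apply, AffineMap.lineMap_apply, dist_vadd_cancel_right, dist_smul₀,
      vsub_eq_sub, vsub_eq_sub, dist_sub_right, hxy]
    simp
    ring
  rw [key x hxz, key y hyz, dist_eq_norm, ← vsub_eq_sub, midpoint_vsub_midpoint, vsub_self,
    midpoint_eq_smul_add, zero_add, norm_smul, vsub_eq_sub, ← dist_eq_norm, h₁ _ _ hXY]
  simp
  ring

end InnerProduct

section Bipyramid

variable {n : ℕ}

/-- Two distinct points of `n`-space at distance `b` from all vertices of a regular simplex on `n`
vertices with edge length `a` have a distance determined by `a` and `b`. -/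
theorem dist_eq_of_regular_bipyramid {a b h : ℝ} (ha : 0 < a) (hh : 0 < h)
    (hab : n * h ^ 2 = 4 * n * b ^ 2 - 2 * (n - 1) * a ^ 2)
    {u : Fin n → EuclideanSpace ℝ (Fin n)} (hu : ∀ i j, i ≠ j → dist (u i) (u j) = a)
    {x y : EuclideanSpace ℝ (Fin n)} (hx : ∀ i, dist x (u i) = b) (hy : ∀ i, dist y (u i) = b)
    (hxy : x ≠ y) : dist x y = h := by
  rcases Nat.eq_zero_or_pos n with rfl | hn
  · exact absurd (Subsingleton.elim x y) hxy
  have hn' : (0 : ℝ) < n := by exact_mod_cast hn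
  set e : Fin n → EuclideanSpace ℝ (Fin n) := fun i => u i - x with he
  have hnorm : ∀ i, ‖e i‖ = b := fun i => by rw [he, ← dist_eq_norm, dist_comm, hx]
  have hinner : ∀ i j,
      inner ℝ (e i) (e j) = (b ^ 2 - a ^ 2 / 2) + if i = j then a ^ 2 / 2 else 0 := by
    intro i j
    split_ifs with hij
    · rw [hij, real_inner_self_eq_norm_sq, hnorm]; ring
    · have h₁ : ‖e i - e j‖ = a := by rw [← hu i j hij, dist_eq_norm]; simp [he]
      have h₂ := norm_sub_sq_real (e i) (e j)
      rw [h₁, hnorm, hnorm] at h₂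
      linarith
  set K : ℝ := n * (b ^ 2 - a ^ 2 / 2) + a ^ 2 / 2 with hK
  have hKh : 4 * K = n * h ^ 2 := by rw [hab, hK]; ring
  have hKpos : 0 < K := by
    have : 0 < n * h ^ 2 := by positivity
    linarith
  have hsum : ∀ g : Fin n → ℝ, ∀ j,
      inner ℝ (e j) (∑ i, g i • e i) = (b ^ 2 - a ^ 2 / 2) * ∑ i, g i + a ^ 2 / 2 * g j := by
    intro g j
    simp only [inner_sum, inner_smul_right, hinner, mul_add, Finset.sum_add_distrib, mul_ite,
      mul_zero, Finset.sum_ite_eq, Finset.mem_univ, if_true, ← Finset.sum_mul]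
    ring
  have hli : LinearIndependent ℝ e := by
    rw [Fintype.linearIndependent_iff]
    intro g hg
    have h₁ : ∀ j, (b ^ 2 - a ^ 2 / 2) * ∑ i, g i + a ^ 2 / 2 * g j = 0 := fun j => by
      rw [← hsum, hg, inner_zero_right]
    have h₂ : K * ∑ i, g i = 0 := by
      have := Finset.sum_congr (rfl : (Finset.univ : Finset (Fin n)) = _) fun j _ => h₁ j
      simp only [Finset.sum_add_distrib, Finset.sum_const, Finset.card_univ, Fintype.card_fin,
        nsmul_eq_mul, ← Finset.mul_sum] at this
      rw [hK]; linarith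
    have h₃ : ∑ i, g i = 0 := (mul_eq_zero.1 h₂).resolve_left hKpos.ne'
    intro j
    have h₄ := h₁ j
    rw [h₃, mul_zero, zero_add] at h₄
    exact (mul_eq_zero.1 h₄).resolve_left (by positivity)
  have : Nonempty (Fin n) := ⟨⟨0, hn⟩⟩
  set B := basisOfLinearIndependentOfCardEqFinrank hli (by simp)
  have hz : ∀ j, inner ℝ (e j) (∑ i, e i) = K := by
    intro j
    have := hsum (fun _ => 1) j
    simp only [one_smul, Finset.sum_const, Finset.card_univ, Fintype.card_fin, nsmul_eq_mul] at this
    rw [this, hK]; ring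
  have hyx : ∀ j, inner ℝ (e j) (y - x) = ‖y - x‖ ^ 2 / 2 := by
    intro j
    have h₁ : ‖e j - (y - x)‖ = b := by rw [← hy j, dist_comm, dist_eq_norm]; simp [he]
    have h₂ := norm_sub_sq_real (e j) (y - x)
    rw [h₁, hnorm] at h₂
    linarith
  have hpar : y - x = (‖y - x‖ ^ 2 / (2 * K)) • ∑ i, e i := by
    refine InnerProductSpace.ext_inner_left_basis B fun j => ?_
    rw [coe_basisOfLinearIndependentOfCardEqFinrank, inner_smul_right, hz, hyx]
    field_simp
  have hzz : ‖∑ i, e i‖ ^ 2 = n * K := by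
    rw [← real_inner_self_eq_norm_sq, sum_inner]
    simp [hz]
  have hpos : 0 < ‖y - x‖ := norm_pos_iff.2 (sub_ne_zero.2 hxy.symm)
  have hsq : ‖y - x‖ ^ 2 = (‖y - x‖ ^ 2 / (2 * K)) ^ 2 * (n * K) := by
    conv_lhs => rw [hpar]
    rw [norm_smul, mul_pow, hzz, Real.norm_eq_abs, sq_abs]
  rw [dist_comm, dist_eq_norm, ← sq_eq_sq₀ hpos.le hh.le]
  field_simp at hsq
  have h₅ : n * ‖y - x‖ ^ 2 = n * h ^ 2 := by linarith
  exact mul_left_cancel₀ hn'.ne' h₅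

/-- Regular bipyramids with prescribed apexes exist. -/
theorem exists_regular_bipyramid {a b h : ℝ} (hn : 0 < n) (ha : 0 < a) (hb : 0 < b) (hh : 0 < h)
    (hab : n * h ^ 2 = 4 * n * b ^ 2 - 2 * (n - 1) * a ^ 2)
    {x y : EuclideanSpace ℝ (Fin n)} (hxy : dist x y = h) :
    ∃ u : Fin n → EuclideanSpace ℝ (Fin n), (∀ i j, i ≠ j → dist (u i) (u j) = a) ∧
      (∀ i, dist x (u i) = b) ∧ ∀ i, dist y (u i) = b := by
  have hn' : (0 : ℝ) < n := by exact_mod_cast hn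
  let e := EuclideanSpace.basisFun (Fin n) ℝ
  set s : EuclideanSpace ℝ (Fin n) := ∑ i, e i with hs
  have hes : ∀ i, inner ℝ (e i) s = 1 := fun i => by
    simp [hs, inner_sum, e.inner_eq_ite]
  have hss : ‖s‖ ^ 2 = n := by
    rw [← real_inner_self_eq_norm_sq]
    nth_rewrite 1 [hs]
    simp [sum_inner, hes]
  have hdist : ∀ c t : ℝ, ∀ i, ‖t • s - c • e i‖ ^ 2 = n * t ^ 2 - 2 * c * t + c ^ 2 := by
    intro c t i
    rw [norm_sub_sq_real, norm_smul, norm_smul, mul_pow, mul_pow, hss, inner_smul_left,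
      inner_smul_right, real_inner_comm, hes, e.norm_eq_one]
    simp
    ring
  have h2 : √2 ^ 2 = (2 : ℝ) := Real.sq_sqrt (by norm_num)
  have hsn : √(n : ℝ) ^ 2 = n := Real.sq_sqrt hn'.le
  have hsn0 : 0 < √(n : ℝ) := Real.sqrt_pos.2 hn'
  set c := a / √2 with hc
  have hc2 : c ^ 2 = a ^ 2 / 2 := by rw [hc, div_pow, h2]
  have hroot : ∀ σ : ℝ, σ ^ 2 = 1 → ∀ i,
      dist ((c / n + σ * (h / (2 * √n))) • s) (c • e i) = b := by
    intro σ hσ i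
    rw [dist_eq_norm, ← sq_eq_sq₀ (norm_nonneg _) hb.le, hdist]
    have h₁ : (h / (2 * √n)) ^ 2 = h ^ 2 / (4 * n) := by rw [div_pow, mul_pow, hsn]; norm_num
    have h₂ : n * (c / n + σ * (h / (2 * √n))) ^ 2 - 2 * c * (c / n + σ * (h / (2 * √n))) + c ^ 2
        = n * (σ ^ 2 * (h / (2 * √n)) ^ 2) + c ^ 2 - c ^ 2 / n := by
      field_simp
      ring
    rw [h₂, hσ, h₁, hc2]
    field_simp
    linarith
  set X := (c / n + 1 * (h / (2 * √n))) • s with hX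
  set Y := (c / n + (-1) * (h / (2 * √n))) • s with hY
  have hXY : dist X Y = dist x y := by
    rw [hxy, dist_eq_norm, hX, hY, ← sub_smul, norm_smul, ← sq_eq_sq₀ (by positivity) hh.le,
      mul_pow, hss, Real.norm_eq_abs, sq_abs]
    rw [show c / n + 1 * (h / (2 * √n)) - (c / n + -1 * (h / (2 * √n))) = h / √n by ring, div_pow,
      hsn]
    field_simp
  obtain ⟨g, hg, hgX, hgY⟩ := exists_isometry_map_pair hXY
  refine ⟨fun i => g (c • e i), fun i j hij => ?_, fun i => ?_, fun i => ?_⟩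
  · rw [hg.dist_eq, dist_eq_norm, ← sq_eq_sq₀ (norm_nonneg _) ha.le, norm_sub_sq_real, norm_smul,
      norm_smul, mul_pow, mul_pow, inner_smul_left, inner_smul_right, e.norm_eq_one, e.norm_eq_one,
      e.inner_eq_zero hij, Real.norm_eq_abs, sq_abs, hc2]
    simp
  · rw [← hgX, hg.dist_eq]; exact hroot 1 (by norm_num) i
  · rw [← hgY, hg.dist_eq]; exact hroot (-1) (by norm_num) i

/-- A map preserving `a` and `b` sends the apexes of a regular bipyramid with base edges `a` and
lateral edges `b` to points that coincide or keep their distance. -/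
theorem PreservesDist.eq_or_dist_eq {f : EuclideanSpace ℝ (Fin n) → EuclideanSpace ℝ (Fin n)}
    {a b h : ℝ} (hfa : PreservesDist f a) (hfb : PreservesDist f b)
    (hn : 0 < n) (ha : 0 < a) (hb : 0 < b) (hh : 0 < h)
    (hab : n * h ^ 2 = 4 * n * b ^ 2 - 2 * (n - 1) * a ^ 2)
    (x y : EuclideanSpace ℝ (Fin n)) (hxy : dist x y = h) :
    f x = f y ∨ dist (f x) (f y) = h := by
  obtain ⟨u, hu, hxu, hyu⟩ := exists_regular_bipyramid hn ha hb hh hab hxy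
  refine or_iff_not_imp_left.2 fun hne => ?_
  exact dist_eq_of_regular_bipyramid ha hh hab (u := fun i => f (u i))
    (fun i j hij => hfa _ _ (hu i j hij)) (fun i => hfb _ _ (hxu i)) (fun i => hfb _ _ (hyu i)) hne

/-- The apexes of a bipyramid made of two regular simplices with edge length `a` have distance
`√(2 + 2 / n) * a`. -/
theorem PreservesDist.sqrt_mul (hn : 2 ≤ n)
    {f : EuclideanSpace ℝ (Fin n) → EuclideanSpace ℝ (Fin n)} {a : ℝ} (ha : 0 < a)
    (hf : PreservesDist f a) : PreservesDist f (√(2 + 2 / n) * a) := by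
  have hn' : (0 : ℝ) < n := by exact_mod_cast (by omega : 0 < n)
  have hr2 : √(2 + 2 / n : ℝ) ^ 2 = 2 + 2 / n := Real.sq_sqrt (by positivity)
  have hr1 : 1 < √(2 + 2 / n : ℝ) := by
    rw [Real.lt_sqrt zero_le_one]
    have : 0 < 2 / (n : ℝ) := by positivity
    linarith
  set h := √(2 + 2 / n : ℝ) * a with hh
  have hah : a < h := by nlinarith
  have hor := hf.eq_or_dist_eq hf (by omega) ha ha (ha.trans hah)
    (by rw [hh, mul_pow, hr2]; field_simp; ring)
  intro x y hxy
  refine (hor x y hxy).resolve_left fun heq => ?_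
  obtain ⟨y₀, hy₀⟩ : ∃ y₀ : EuclideanSpace ℝ (Fin n), dist 0 y₀ = a :=
    ⟨EuclideanSpace.single ⟨0, by omega⟩ a, by simp [abs_of_pos ha]⟩
  obtain ⟨x₀, hx₀, hx₀'⟩ := exists_dist_eq_of_dist_le_two_mul (by simpa using hn) (b := h)
    (show dist 0 y₀ ≤ 2 * h by linarith)
  obtain ⟨g, hg, hgx, hgy⟩ := exists_isometry_map_pair
    (show dist x₀ y₀ = dist x y by rw [hxy, dist_comm, hx₀'])
  have h₁ := hf (g 0) y (by rw [← hgy, hg.dist_eq, hy₀])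
  rw [← heq] at h₁
  rcases hor (g 0) x (by rw [← hgx, hg.dist_eq, hx₀]) with h₂ | h₂
  · rw [h₂, dist_self] at h₁
    exact ha.ne h₁
  · exact hah.ne (h₁.symm.trans h₂)

theorem PreservesDist.pow_mul {E : Type*} [Dist E] {f : E → E} {c δ : ℝ} (hc : 0 < c) (hδ : 0 < δ)
    (hstep : ∀ a, 0 < a → PreservesDist f a → PreservesDist f (c * a)) (hf : PreservesDist f δ)
    (k : ℕ) : PreservesDist f (c ^ k * δ) := by
  induction k with
  | zero => simpa using hf
  | succ k ih =>
    rw [pow_succ', mul_assoc]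
    exact hstep _ (by positivity) ih

theorem PreservesDist.exists_large (hn : 2 ≤ n)
    {f : EuclideanSpace ℝ (Fin n) → EuclideanSpace ℝ (Fin n)} {δ : ℝ} (hδ : 0 < δ)
    (hf : PreservesDist f δ) (M : ℝ) : ∃ D, M ≤ D ∧ PreservesDist f D := by
  have hr : 1 < √(2 + 2 / n : ℝ) := by
    rw [Real.lt_sqrt zero_le_one]
    have : 0 ≤ 2 / (n : ℝ) := by positivity
    linarith
  obtain ⟨k, hk⟩ := pow_unbounded_of_one_lt (M / δ) hr
  exact ⟨_, ((div_lt_iff₀ hδ).1 hk).le,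
    hf.pow_mul (by linarith) hδ (fun a ha h => h.sqrt_mul hn ha) k⟩

theorem PreservesDist.half_of_plane
    {f : EuclideanSpace ℝ (Fin 2) → EuclideanSpace ℝ (Fin 2)} {a : ℝ} (ha : 0 < a)
    (hf : PreservesDist f a) : PreservesDist f (1 / 2 * a) := by
  have h₃ : PreservesDist f (3 * a) := by
    have := (hf.sqrt_mul le_rfl ha).sqrt_mul le_rfl (by positivity)
    rw [← mul_assoc, Real.mul_self_sqrt (by positivity)] at this
    norm_num at this
    exact this
  have := hf.half (by simp) ha (hf.two_mul (by simp) ha h₃)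
  rwa [show 1 / 2 * a = a / 2 by ring]

/-- Regular bipyramids with lateral edges `a` and base edges `√(2 + 2 / n) * a` shrink distances by
the factor `2 / n`. -/
theorem PreservesDist.two_div_mul (hn : 2 ≤ n)
    {f : EuclideanSpace ℝ (Fin n) → EuclideanSpace ℝ (Fin n)} {a : ℝ} (ha : 0 < a)
    (hf : PreservesDist f a) : PreservesDist f (2 / n * a) := by
  have hn' : (0 : ℝ) < n := by exact_mod_cast (by omega : 0 < n)
  have hr2 : √(2 + 2 / n : ℝ) ^ 2 = 2 + 2 / n := Real.sq_sqrt (by positivity)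
  refine .of_eq_or_dist_eq (by simpa using hn) (hf.exists_large hn ha) (by positivity) ?_
  refine (hf.sqrt_mul hn ha).eq_or_dist_eq hf (by omega) (by positivity) ha (by positivity) ?_
  rw [mul_pow, mul_pow, hr2]
  field_simp
  ring

/-- Some ratio less than `1` maps preserved distances to preserved distances. -/
theorem exists_contracting_ratio (hn : 2 ≤ n)
    (f : EuclideanSpace ℝ (Fin n) → EuclideanSpace ℝ (Fin n)) :
    ∃ c : ℝ, 0 < c ∧ c < 1 ∧ ∀ a, 0 < a → PreservesDist f a → PreservesDist f (c * a) := by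
  rcases hn.eq_or_lt with rfl | h
  · exact ⟨1 / 2, by norm_num, by norm_num, fun a ha hf => hf.half_of_plane ha⟩
  · have hn' : (2 : ℝ) < n := by exact_mod_cast h
    exact ⟨2 / n, by positivity, (div_lt_one (by linarith)).2 hn',
      fun a ha hf => hf.two_div_mul hn ha⟩

end Bipyramid

/-- **Beckman–Quarles theorem**: a map of Euclidean `n`-space (`n ≥ 2`) that
preserves some fixed distance `δ > 0` preserves all distances, and is hence a
Euclidean motion (an affine isometry). -/
theorem beckman_quarles (n : ℕ) (hn : 2 ≤ n) (δ : ℝ) (hδ : 0 < δ)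
    (f : EuclideanSpace ℝ (Fin n) → EuclideanSpace ℝ (Fin n))
    (hf : ∀ x y, dist x y = δ → dist (f x) (f y) = δ) :
    (∀ x y, dist (f x) (f y) = dist x y) ∧
    ∃ g : EuclideanSpace ℝ (Fin n) ≃ᵃⁱ[ℝ] EuclideanSpace ℝ (Fin n),
      ∀ x, f x = g x := by
  have hfδ : PreservesDist f δ := hf
  obtain ⟨c, hc, hc1, hstep⟩ := exists_contracting_ratio hn f
  have hiso : Isometry f := by
    refine isometry_of_preservesDist_small_large (by simpa using hn) (fun η hη => ?_)
      (hfδ.exists_large hn hδ)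
    obtain ⟨k, hk⟩ := exists_pow_lt_of_lt_one (show 0 < η / δ by positivity) hc1
    exact ⟨_, by positivity, ((lt_div_iff₀ hδ).1 hk).le, hfδ.pow_mul hc hδ hstep k⟩
  exact ⟨hiso.dist_eq, hiso.affineIsometryOfStrictConvexSpace.toAffineIsometryEquiv rfl,
    fun x => by simp⟩
end
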